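/- Let A be a unital simple C*-algebra with T(A) ≠ ∅. Then the following are equivalent: (i) every positive element of A has tracial approximate oscillation zero; (ii) for every positive e ∈ A and every ε > 0 there exists a sequence (b_n) of mutually orthogonal positive contractions in Her(e) with ∑_{n=1}^∞ ω(b_n) < ε and d_τ(e) − ∑_{n=1}^∞ τ(b_n) < ε for all τ ∈ T(A); (iii) for every positive e ∈ A and every ε > 0 there exists a sequence (b_n) of mutually orthogonal positive contractions in Her(e) with ∑_{n=1}^∞ ω(b_n) < ε and d_τ(e) − ∑_{n=1}^∞ d_τ(b_n) < ε for all τ ∈ T(A). -/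

import Mathlib

open scoped ComplexOrder

/-- A tracial state on a C*-algebra: a positive linear functional of norm one which is
tracial (`τ(xy) = τ(yx)`). -/
def IsTracialState {A : Type*} [NonUnitalNormedRing A] [StarRing A] [NormedSpace ℂ A]
    (τ : A →L[ℂ] ℂ) : Prop :=
  (∀ x : A, 0 ≤ τ (star x * x)) ∧ ‖τ‖ = 1 ∧ ∀ x y : A, τ (x * y) = τ (y * x)

/-- The set `T(A)` of tracial states of `A`. -/
def traceSet (A : Type*) [CStarAlgebra A] : Set (A →L[ℂ] ℂ) := {τ | IsTracialState τ}

/-- The function `f_ε : ℝ → [0,1]`: `0` on `(-∞, ε]`, `1` on `[2ε, ∞)`, linear on `[ε, 2ε]`. -/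
noncomputable def fE (ε : ℝ) : ℝ → ℝ := fun t => min 1 (max 0 ((t - ε) / ε))

variable {A : Type*} [CStarAlgebra A]

/-- `d_τ(a) := sup_n τ(f_{1/n}(a))`. -/
noncomputable def dTau (τ : A →L[ℂ] ℂ) (a : A) : ℝ :=
  ⨆ n : ℕ, (τ (cfc (fE (1 / (n + 1 : ℝ))) a)).re

/-- The tracial oscillation `ω(a) = lim_n sup_{τ ∈ T(A)} (d_τ(a) − τ(f_{1/n}(a)))`; since the
sequence of suprema is nonincreasing, the limit is the infimum. -/
noncomputable def osc (a : A) : ℝ :=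
  ⨅ n : ℕ, ⨆ τ : ↥(traceSet A),
    (dTau (τ : A →L[ℂ] ℂ) a - ((τ : A →L[ℂ] ℂ) (cfc (fE (1 / (n + 1 : ℝ))) a)).re)

/-- The tracial 2-seminorm `‖x‖₂ = sup_{τ ∈ T(A)} τ(x*x)^{1/2}`. -/
noncomputable def norm2 (x : A) : ℝ :=
  ⨆ τ : ↥(traceSet A), Real.sqrt (((τ : A →L[ℂ] ℂ) (star x * x)).re)

/-- The hereditary C*-subalgebra generated by `a`, i.e. the norm closure of `aAa`. -/
def her (a : A) : Set A := closure {y : A | ∃ x : A, y = a * x * a}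

/-- An element `a` has tracial approximate oscillation zero if for every `ε > 0` there is a
positive `c ∈ Her(a)` with `‖c‖ ≤ ‖a‖`, `‖a − c‖₂ < ε` and `ω(c) < ε`. -/
def TAOZero [PartialOrder A] [StarOrderedRing A] (a : A) : Prop :=
  ∀ ε > 0, ∃ c ∈ her a, 0 ≤ c ∧ ‖c‖ ≤ ‖a‖ ∧ norm2 (a - c) < ε ∧ osc c < ε

open Filter Topology

section Trace

lemma re_apply_one_le_norm [Nontrivial A] (τ : A →L[ℂ] ℂ) : (τ 1).re ≤ ‖τ‖ := by
  calc (τ 1).re ≤ ‖τ 1‖ := Complex.re_le_norm _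
    _ ≤ ‖τ‖ * ‖(1 : A)‖ := τ.le_opNorm 1
    _ = ‖τ‖ := by rw [CStarRing.norm_one, mul_one]

namespace IsTracialState

lemma re_le_norm {τ : A →L[ℂ] ℂ} (h : IsTracialState τ) (x : A) : (τ x).re ≤ ‖x‖ := by
  calc (τ x).re ≤ ‖τ x‖ := Complex.re_le_norm _
    _ ≤ ‖τ‖ * ‖x‖ := τ.le_opNorm x
    _ = ‖x‖ := by rw [h.2.1, one_mul]

lemma re_smul (τ : A →L[ℂ] ℂ) (r : ℝ) (x : A) : (τ (r • x)).re = r * (τ x).re := by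
  rw [← Complex.coe_smul, map_smul, smul_eq_mul, Complex.re_ofReal_mul]

end IsTracialState

variable [PartialOrder A] [StarOrderedRing A]

namespace IsTracialState

variable {τ : A →L[ℂ] ℂ}

lemma apply_nonneg (h : IsTracialState τ) {x : A} (hx : 0 ≤ x) : 0 ≤ τ x := by
  obtain ⟨s, rfl⟩ := CStarAlgebra.nonneg_iff_eq_star_mul_self.mp hx
  exact h.1 s

lemma re_nonneg (h : IsTracialState τ) {x : A} (hx : 0 ≤ x) : 0 ≤ (τ x).re :=
  (Complex.nonneg_iff.mp (h.apply_nonneg hx)).1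

lemma re_mono (h : IsTracialState τ) {x y : A} (hxy : x ≤ y) : (τ x).re ≤ (τ y).re := by
  have := h.re_nonneg (sub_nonneg.mpr hxy)
  simpa using this

end IsTracialState

/-- A positive functional on a unital C*-algebra satisfies `‖τ x‖ ≤ τ 1 * ‖x‖`. -/
lemma norm_apply_le_re_apply_one {τ : A →L[ℂ] ℂ} (h : ∀ x : A, 0 ≤ τ (star x * x)) (x : A) :
    ‖τ x‖ ≤ (τ 1).re * ‖x‖ := by
  have hpos : ∀ y : A, 0 ≤ y → 0 ≤ τ y := by
    intro y hy
    obtain ⟨s, rfl⟩ := CStarAlgebra.nonneg_iff_eq_star_mul_self.mp hy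
    exact h s
  let f : A →ₚ[ℂ] ℂ := PositiveLinearMap.mk₀ τ.toLinearMap hpos
  have hf : ∀ y, f y = τ y := fun y => rfl
  have h1 : 0 ≤ (τ 1).re := (Complex.nonneg_iff.mp (hpos 1 zero_le_one)).1
  have key := norm_inner_le_norm (𝕜 := ℂ) (f.toPreGNS 1) (f.toPreGNS x)
  rw [f.preGNS_inner_def] at key
  have n1 := f.preGNS_norm_sq (f.toPreGNS 1)
  have n2 := f.preGNS_norm_sq (f.toPreGNS x)
  simp only [PositiveLinearMap.ofPreGNS_toPreGNS, hf, star_one, one_mul, mul_one] at key n1 n2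
  have hxx : (τ (star x * x)).re ≤ (τ 1).re * ‖x‖ ^ 2 := by
    have h3 : 0 ≤ algebraMap ℝ A (‖x‖ ^ 2) - star x * x :=
      sub_nonneg.mpr CStarAlgebra.star_mul_le_algebraMap_norm_sq
    have h4 := (Complex.nonneg_iff.mp (hpos _ h3)).1
    rw [Algebra.algebraMap_eq_smul_one, map_sub, ← Complex.coe_smul, map_smul, Complex.sub_re,
      smul_eq_mul, Complex.re_ofReal_mul] at h4
    linarith
  have n1' : ‖f.toPreGNS 1‖ ^ 2 = (τ 1).re := by rw [← n1]; norm_cast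
  have n2' : ‖f.toPreGNS x‖ ^ 2 = (τ (star x * x)).re := by rw [← n2]; norm_cast
  have : ‖τ x‖ ^ 2 ≤ ((τ 1).re * ‖x‖) ^ 2 := by
    calc ‖τ x‖ ^ 2 ≤ (‖f.toPreGNS 1‖ * ‖f.toPreGNS x‖) ^ 2 := by gcongr
      _ = (τ 1).re * (τ (star x * x)).re := by rw [mul_pow, n1', n2']
      _ ≤ (τ 1).re * ((τ 1).re * ‖x‖ ^ 2) := by gcongr
      _ = _ := by ring
  exact le_of_sq_le_sq this (by positivity)

lemma isTracialState_iff [Nontrivial A] {τ : A →L[ℂ] ℂ} :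
    IsTracialState τ ↔ (∀ x : A, 0 ≤ τ (star x * x)) ∧ (τ 1).re = 1 ∧
      ∀ x y : A, τ (x * y) = τ (y * x) := by
  refine and_congr_right fun h => and_congr_left fun _ => ?_
  have h0 : 0 ≤ (τ 1).re := by
    have := (Complex.nonneg_iff.mp (h 1)).1
    simpa using this
  have : ‖τ‖ = (τ 1).re :=
    le_antisymm (τ.opNorm_le_bound h0 (norm_apply_le_re_apply_one h)) (re_apply_one_le_norm τ)
  rw [this]

namespace IsTracialState

variable {τ : A →L[ℂ] ℂ}

lemma re_one [Nontrivial A] (h : IsTracialState τ) : (τ 1).re = 1 := (isTracialState_iff.mp h).2.1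

lemma re_le_one [Nontrivial A] (h : IsTracialState τ) {x : A} (hx : x ≤ 1) : (τ x).re ≤ 1 :=
  (h.re_mono hx).trans_eq h.re_one

lemma re_mul_nonneg (h : IsTracialState τ) {x y : A} (hx : 0 ≤ x) (hy : 0 ≤ y) :
    0 ≤ (τ (x * y)).re := by
  obtain ⟨s, rfl⟩ := CStarAlgebra.nonneg_iff_eq_star_mul_self.mp hx
  rw [mul_assoc, h.2.2]
  exact h.re_nonneg (star_right_conjugate_nonneg hy s)

/-- Monotonicity of `x ↦ τ (y x)` for positive `y`. -/
lemma re_mul_mono (h : IsTracialState τ) {x y z : A} (hy : 0 ≤ y) (hxz : x ≤ z) :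
    (τ (y * x)).re ≤ (τ (y * z)).re := by
  have := h.re_mul_nonneg hy (sub_nonneg.mpr hxz)
  rw [mul_sub, map_sub, Complex.sub_re] at this
  linarith

lemma sq_re_le (h : IsTracialState τ) [Nontrivial A] {x : A} (hx : IsSelfAdjoint x) :
    (τ x).re ^ 2 ≤ (τ (star x * x)).re := by
  set r := (τ x).re with hr
  have h1 := h.re_nonneg (star_mul_self_nonneg (x - algebraMap ℝ A r))
  have h2 : star (x - algebraMap ℝ A r) * (x - algebraMap ℝ A r) =
      star x * x - (2 * r) • x + (r ^ 2) • (1 : A) := by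
    rw [Algebra.algebraMap_eq_smul_one, star_sub, hx.star_eq, star_smul, star_one]
    simp only [sub_mul, mul_sub, smul_mul_assoc, mul_smul_comm, one_mul, mul_one, star_trivial]
    module
  rw [h2, map_add, map_sub, Complex.add_re, Complex.sub_re, re_smul, re_smul, h.re_one,
    ← hr] at h1
  nlinarith

end IsTracialState

lemma isCompact_tracialState [Nontrivial A] :
    IsCompact {φ : WeakDual ℂ A | IsTracialState (WeakDual.toStrongDual φ)} := by
  have hcl : IsClosed {φ : WeakDual ℂ A | IsTracialState (WeakDual.toStrongDual φ)} := by
    have : {φ : WeakDual ℂ A | IsTracialState (WeakDual.toStrongDual φ)} =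
        (⋂ x : A, {φ : WeakDual ℂ A | 0 ≤ φ (star x * x)}) ∩
        ({φ : WeakDual ℂ A | (φ 1).re = 1} ∩
          ⋂ x : A, ⋂ y : A, {φ : WeakDual ℂ A | φ (x * y) = φ (y * x)}) := by
      ext φ
      simp only [Set.mem_ofPred_eq, isTracialState_iff, Set.mem_inter_iff, Set.mem_iInter]
      rfl
    rw [this]
    refine IsClosed.inter (isClosed_iInter fun x => ?_) (IsClosed.inter ?_
      (isClosed_iInter fun x => isClosed_iInter fun y => ?_))
    · exact isClosed_le continuous_const (WeakDual.eval_continuous _)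
    · exact isClosed_eq (Complex.continuous_re.comp (WeakDual.eval_continuous _)) continuous_const
    · exact isClosed_eq (WeakDual.eval_continuous _) (WeakDual.eval_continuous _)
  refine (WeakDual.isCompact_closedBall (0 : StrongDual ℂ A) 1).of_isClosed_subset hcl ?_
  intro φ hφ
  have := hφ.2.1
  simp only [Set.mem_preimage, mem_closedBall_zero_iff]
  exact this.le

/-- Dini's theorem on the trace simplex, for affine functions given by elements of `A`. -/
lemma exists_forall_re_pos_of_monotone [Nontrivial A] (x : ℕ → A)
    (hmono : ∀ τ : A →L[ℂ] ℂ, IsTracialState τ → Monotone fun n => (τ (x n)).re)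
    (hpos : ∀ τ : A →L[ℂ] ℂ, IsTracialState τ → ∃ n, 0 < (τ (x n)).re) :
    ∃ n, ∀ τ : A →L[ℂ] ℂ, IsTracialState τ → 0 < (τ (x n)).re := by
  let K := {φ : WeakDual ℂ A | IsTracialState (WeakDual.toStrongDual φ)}
  have hK : IsCompact K := isCompact_tracialState
  obtain ⟨t, ht⟩ := hK.elim_finite_subcover (fun n => {φ : WeakDual ℂ A | 0 < (φ (x n)).re})
    (fun n => isOpen_lt continuous_const
      (Complex.continuous_re.comp (WeakDual.eval_continuous _)))
    (fun φ hφ => by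
      obtain ⟨n, hn⟩ := hpos _ hφ
      exact Set.mem_iUnion.mpr ⟨n, hn⟩)
  refine ⟨t.sup id, fun τ hτ => ?_⟩
  have hmem : StrongDual.toWeakDual τ ∈ K := hτ
  obtain ⟨n, hn, hn'⟩ := Set.mem_iUnion₂.mp (ht hmem)
  exact lt_of_lt_of_le hn' (hmono τ hτ (Finset.le_sup (f := id) hn))

end Trace

section Cutoff

lemma continuous_fE (ε : ℝ) : Continuous (fE ε) := by
  unfold fE
  fun_prop

lemma fE_nonneg (ε t : ℝ) : 0 ≤ fE ε t := le_min zero_le_one (le_max_left _ _)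

lemma fE_le_one (ε t : ℝ) : fE ε t ≤ 1 := min_le_left _ _

lemma fE_eq_zero {ε t : ℝ} (hε : 0 < ε) (ht : t ≤ ε) : fE ε t = 0 := by
  have : (t - ε) / ε ≤ 0 := div_nonpos_of_nonpos_of_nonneg (by linarith) hε.le
  simp [fE, max_eq_left this]

lemma fE_eq_one {ε t : ℝ} (hε : 0 < ε) (ht : 2 * ε ≤ t) : fE ε t = 1 := by
  have : 1 ≤ (t - ε) / ε := by rw [le_div_iff₀ hε]; linarith
  exact min_eq_left (this.trans (le_max_right _ _))

lemma fE_le_div {ε t : ℝ} (hε : 0 < ε) (ht : 0 ≤ t) : fE ε t ≤ t / ε :=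
  (min_le_right _ _).trans (max_le (by positivity) (by gcongr; linarith))

lemma fE_anti {ε δ t : ℝ} (hδ : 0 < δ) (h : δ ≤ ε) (ht : 0 ≤ t) : fE ε t ≤ fE δ t := by
  have hε : 0 < ε := hδ.trans_le h
  unfold fE
  rw [sub_div, sub_div, div_self hε.ne', div_self hδ.ne']
  gcongr

/-- The element `f_{1/(n+1)}(a)`. -/
noncomputable abbrev cutoff (n : ℕ) (a : A) : A := cfc (fE (1 / (n + 1 : ℝ))) a

/-- `f_{1/(2n+2)}` is a unit for `f_{1/(n+1)}`. -/
lemma cutoff_mul_cutoff (n : ℕ) (a : A) :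
    cutoff (2 * n + 1) a * cutoff n a = cutoff n a := by
  rw [cutoff, cutoff, ← cfc_mul _ _ a (continuous_fE _).continuousOn (continuous_fE _).continuousOn]
  refine cfc_congr fun t _ => ?_
  have hn : (0 : ℝ) < n + 1 := by positivity
  have hε : (0 : ℝ) < 1 / (((2 * n + 1 : ℕ) : ℝ) + 1) := by positivity
  have h2 : 2 * (1 / (((2 * n + 1 : ℕ) : ℝ) + 1)) = 1 / (n + 1 : ℝ) := by
    push_cast
    field_simp
    ring
  rcases le_total t (1 / (n + 1 : ℝ)) with h | h
  · rw [fE_eq_zero (by positivity) h, mul_zero]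
  · rw [fE_eq_one hε (h2.trans_le h), one_mul]

variable [PartialOrder A] [StarOrderedRing A]

lemma spectrum_real_nonneg {a : A} (ha : 0 ≤ a) {t : ℝ} (ht : t ∈ spectrum ℝ a) : 0 ≤ t :=
  spectrum_nonneg_of_nonneg ha ht

lemma cutoff_nonneg (n : ℕ) (a : A) : 0 ≤ cutoff n a :=
  cfc_nonneg fun _ _ => fE_nonneg _ _

lemma cutoff_le_one (n : ℕ) (a : A) : cutoff n a ≤ 1 :=
  cfc_le_one _ _ fun _ _ => fE_le_one _ _

lemma norm_le_one_of_le_one {x : A} (h0 : 0 ≤ x) (h1 : x ≤ 1) : ‖x‖ ≤ 1 :=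
  (CStarAlgebra.norm_le_one_iff_of_nonneg x).mpr h1

lemma norm_cutoff_le_one (n : ℕ) (a : A) : ‖cutoff n a‖ ≤ 1 :=
  norm_le_one_of_le_one (cutoff_nonneg n a) (cutoff_le_one n a)

lemma cutoff_mono {a : A} (ha : 0 ≤ a) : Monotone fun n => cutoff n a := by
  intro m n hmn
  refine cfc_mono (fun t ht => ?_) (continuous_fE _).continuousOn (continuous_fE _).continuousOn
  have : (m : ℝ) ≤ n := by exact_mod_cast hmn
  exact fE_anti (by positivity) (by gcongr) (spectrum_real_nonneg ha ht)

lemma cutoff_le_smul {a : A} (ha : 0 ≤ a) (n : ℕ) : cutoff n a ≤ (n + 1 : ℝ) • a := by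
  rw [← cfc_const_mul_id (R := ℝ) (n + 1 : ℝ) a]
  refine cfc_mono (fun t ht => ?_) (continuous_fE _).continuousOn (by fun_prop)
  have := fE_le_div (ε := 1 / (n + 1 : ℝ)) (by positivity) (spectrum_real_nonneg ha ht)
  rwa [div_div_eq_mul_div, div_one, mul_comm] at this

lemma tendsto_cutoff_mul_self {a : A} (ha : 0 ≤ a) :
    Tendsto (fun n => cutoff n a * a) atTop (𝓝 a) := by
  rw [tendsto_iff_norm_sub_tendsto_zero]
  refine squeeze_zero (fun _ => norm_nonneg _) (fun n => ?_)
    ((tendsto_one_div_add_atTop_nhds_zero_nat (𝕜 := ℝ)).const_mul 2 |>.trans_eq (by simp))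
  have hε : (0 : ℝ) < 1 / (n + 1 : ℝ) := by positivity
  have h1 : cutoff n a * a - a = cfc (fun t => fE (1 / (n + 1 : ℝ)) t * t - t) a := by
    rw [cfc_sub (fun t => fE (1 / (n + 1 : ℝ)) t * t) (fun t => t) a
      (((continuous_fE _).mul continuous_id).continuousOn) continuousOn_id,
      cfc_mul (fE _) (fun t => t) a (continuous_fE _).continuousOn continuousOn_id, cfc_id' ℝ a]
  rw [h1]
  refine norm_cfc_le (by positivity) fun t ht => ?_
  have ht0 := spectrum_real_nonneg ha ht
  rw [Real.norm_eq_abs, abs_le]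
  have f0 := fE_nonneg (1 / (n + 1 : ℝ)) t
  have f1 := fE_le_one (1 / (n + 1 : ℝ)) t
  rcases le_total (2 * (1 / (n + 1 : ℝ))) t with h | h
  · rw [fE_eq_one hε h]
    constructor <;> linarith
  · constructor <;> nlinarith

end Cutoff

section Her

lemma isClosed_her (a : A) : IsClosed (her a) := isClosed_closure

/-- The hereditary subalgebra contains `f(a)` when `f` vanishes near zero. -/
lemma exists_cfc_eq {a : A} (ha : IsSelfAdjoint a) {f : ℝ → ℝ} (hf : Continuous f) {δ : ℝ}
    (hδ : 0 < δ) (h0 : ∀ t ≤ δ, f t = 0) : ∃ k : A, cfc f a = a * k ∧ cfc f a = k * a := by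
  have hk : Continuous fun t => f t / max t δ :=
    hf.div (by fun_prop) fun t => (hδ.trans_le (le_max_right _ _)).ne'
  have hfk : ∀ t, f t = t * (f t / max t δ) := by
    intro t
    rcases le_total t δ with h | h
    · simp [h0 t h]
    · rw [max_eq_left h]
      field_simp [(hδ.trans_le h).ne']
  have h1 : cfc f a = a * cfc (fun t => f t / max t δ) a := by
    nth_rewrite 2 [← cfc_id' ℝ a]
    rw [← cfc_mul (fun t => t) _ a continuousOn_id hk.continuousOn]
    exact cfc_congr fun t _ => hfk t
  refine ⟨_, h1, ?_⟩
  nth_rewrite 3 [← cfc_id' ℝ a]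
  rw [← cfc_mul _ (fun t => t) a hk.continuousOn continuousOn_id]
  exact cfc_congr fun t _ => by rw [mul_comm]; exact hfk t

lemma star_mem_her {a x : A} (ha : IsSelfAdjoint a) (hx : x ∈ her a) : star x ∈ her a := by
  refine map_mem_closure continuous_star hx ?_
  rintro _ ⟨y, rfl⟩
  exact ⟨star y, by simp [ha.star_eq, mul_assoc]⟩

/-- A contractive left unit for `a` in the limit is one for the hereditary subalgebra. -/
lemma tendsto_mul_of_mem_her {a x : A} {w : ℕ → A} (hw : ∀ n, ‖w n‖ ≤ 1)
    (hwa : Tendsto (fun n => w n * a) atTop (𝓝 a)) (hx : x ∈ her a) :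
    Tendsto (fun n => w n * x) atTop (𝓝 x) := by
  rw [Metric.tendsto_atTop]
  intro ε hε
  obtain ⟨_, ⟨y, rfl⟩, hy⟩ := Metric.mem_closure_iff.mp hx (ε / 3) (by positivity)
  have h1 : Tendsto (fun n => w n * (a * y * a)) atTop (𝓝 (a * y * a)) := by
    have := (hwa.mul_const y).mul_const a
    simpa [mul_assoc] using this
  obtain ⟨N, hN⟩ := Metric.tendsto_atTop.mp h1 (ε / 3) (by positivity)
  refine ⟨N, fun n hn => ?_⟩
  have h2 : dist (w n * x) (w n * (a * y * a)) ≤ dist x (a * y * a) := by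
    rw [dist_eq_norm, ← mul_sub, dist_eq_norm]
    calc ‖w n * (x - a * y * a)‖ ≤ ‖w n‖ * ‖x - a * y * a‖ := norm_mul_le _ _
      _ ≤ 1 * ‖x - a * y * a‖ := by gcongr; exact hw n
      _ = _ := one_mul _
  calc dist (w n * x) x ≤ dist (w n * x) (w n * (a * y * a)) + dist (w n * (a * y * a)) (a * y * a)
        + dist (a * y * a) x := dist_triangle4 _ _ _ _
    _ < ε := by
      rw [dist_comm (a * y * a) x]
      have := hN n hn
      linarith

lemma tendsto_mul_of_mem_her' {a x : A} (ha : IsSelfAdjoint a) {w : ℕ → A}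
    (hws : ∀ n, IsSelfAdjoint (w n)) (hw : ∀ n, ‖w n‖ ≤ 1)
    (hwa : Tendsto (fun n => w n * a) atTop (𝓝 a)) (hx : x ∈ her a) :
    Tendsto (fun n => x * w n) atTop (𝓝 x) := by
  have := (tendsto_mul_of_mem_her hw hwa (star_mem_her ha hx)).star
  simpa [(hws _).star_eq] using this

lemma tendsto_conj {x : A} {w : ℕ → A} (hw : ∀ n, ‖w n‖ ≤ 1)
    (h1 : Tendsto (fun n => w n * x) atTop (𝓝 x)) (h2 : Tendsto (fun n => x * w n) atTop (𝓝 x)) :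
    Tendsto (fun n => w n * x * w n) atTop (𝓝 x) := by
  rw [tendsto_iff_norm_sub_tendsto_zero] at *
  refine squeeze_zero (fun _ => norm_nonneg _) (fun n => ?_) ((h2.add h1).trans_eq (by simp))
  calc ‖w n * x * w n - x‖ = ‖w n * (x * w n - x) + (w n * x - x)‖ := by
        congr 1; noncomm_ring
    _ ≤ ‖w n * (x * w n - x)‖ + ‖w n * x - x‖ := norm_add_le _ _
    _ ≤ ‖w n‖ * ‖x * w n - x‖ + ‖w n * x - x‖ := by gcongr; exact norm_mul_le _ _
    _ ≤ 1 * ‖x * w n - x‖ + ‖w n * x - x‖ := by gcongr; exact hw n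
    _ = _ := by rw [one_mul]

lemma mul_eq_zero_of_mem_her {a b x y : A} (hab : a * b = 0) (hx : x ∈ her a) (hy : y ∈ her b) :
    x * y = 0 := by
  have h1 : a * y = 0 := by
    have hcl : IsClosed {y : A | a * y = 0} :=
      isClosed_eq (continuous_const.mul continuous_id) continuous_const
    refine closure_minimal ?_ hcl hy
    rintro _ ⟨z, rfl⟩
    simp [← mul_assoc, hab]
  have hcl : IsClosed {x : A | x * y = 0} :=
    isClosed_eq (continuous_id.mul continuous_const) continuous_const
  refine closure_minimal ?_ hcl hx
  rintro _ ⟨z, rfl⟩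
  simp [mul_assoc, h1]

variable [PartialOrder A] [StarOrderedRing A]

lemma mem_her_iff {a x : A} (ha : 0 ≤ a) : x ∈ her a ↔
    Tendsto (fun n => cutoff n a * x) atTop (𝓝 x) ∧
      Tendsto (fun n => x * cutoff n a) atTop (𝓝 x) := by
  have hsa : IsSelfAdjoint a := .of_nonneg ha
  constructor
  · intro hx
    exact ⟨tendsto_mul_of_mem_her (norm_cutoff_le_one · a) (tendsto_cutoff_mul_self ha) hx,
      tendsto_mul_of_mem_her' hsa (fun n => .of_nonneg (cutoff_nonneg n a))
        (norm_cutoff_le_one · a) (tendsto_cutoff_mul_self ha) hx⟩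
  · rintro ⟨h1, h2⟩
    refine mem_closure_of_tendsto (tendsto_conj (norm_cutoff_le_one · a) h1 h2)
      (Eventually.of_forall fun n => ?_)
    have hε : (0 : ℝ) < 1 / (n + 1 : ℝ) := by positivity
    obtain ⟨k, hk1, hk2⟩ := exists_cfc_eq hsa (continuous_fE (1 / (n + 1 : ℝ))) hε
      (fun t ht => fE_eq_zero hε ht)
    refine ⟨k * x * k, ?_⟩
    calc cutoff n a * x * cutoff n a = (a * k) * x * (k * a) := by
          rw [← hk1, ← hk2]
      _ = _ := by noncomm_ring

lemma mul_mem_her {a x y : A} (ha : 0 ≤ a) (hx : x ∈ her a) (z : A) (hy : y ∈ her a) :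
    x * z * y ∈ her a := by
  rw [mem_her_iff ha] at *
  constructor
  · simpa [mul_assoc] using hx.1.mul_const (z * y)
  · simpa [mul_assoc] using hy.2.const_mul (x * z)

lemma add_mem_her {a x y : A} (ha : 0 ≤ a) (hx : x ∈ her a) (hy : y ∈ her a) :
    x + y ∈ her a := by
  rw [mem_her_iff ha] at *
  exact ⟨by simpa [mul_add] using hx.1.add hy.1, by simpa [add_mul] using hx.2.add hy.2⟩

lemma sub_mem_her {a x y : A} (ha : 0 ≤ a) (hx : x ∈ her a) (hy : y ∈ her a) :
    x - y ∈ her a := by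
  rw [mem_her_iff ha] at *
  exact ⟨by simpa [mul_sub] using hx.1.sub hy.1, by simpa [sub_mul] using hx.2.sub hy.2⟩

lemma sum_mem_her {ι : Type*} (s : Finset ι) {a : A} {x : ι → A} (ha : 0 ≤ a)
    (hx : ∀ i ∈ s, x i ∈ her a) : ∑ i ∈ s, x i ∈ her a :=
  Finset.sum_induction x (· ∈ her a) (fun _ _ => add_mem_her ha)
    ((mem_her_iff ha).mpr (by simp)) hx

lemma her_subset_her {a b : A} (ha : 0 ≤ a) (hb : b ∈ her a) : her b ⊆ her a := by
  refine closure_minimal ?_ (isClosed_her a)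
  rintro _ ⟨y, rfl⟩
  exact mul_mem_her ha hb y hb

lemma self_mem_her {a : A} (ha : 0 ≤ a) : a ∈ her a := by
  have h := tendsto_cutoff_mul_self ha
  refine (mem_her_iff ha).mpr ⟨h, ?_⟩
  simpa [(IsSelfAdjoint.of_nonneg ha).star_eq,
    (IsSelfAdjoint.of_nonneg (cutoff_nonneg _ a)).star_eq] using h.star

lemma cutoff_mem_her {a : A} (ha : 0 ≤ a) (n : ℕ) : cutoff n a ∈ her a := by
  have hε : (0 : ℝ) < 1 / (n + 1 : ℝ) := by positivity
  obtain ⟨k, hk1, hk2⟩ := exists_cfc_eq (.of_nonneg ha) (continuous_fE (1 / (n + 1 : ℝ))) hε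
    (fun t ht => fE_eq_zero hε ht)
  have h := tendsto_cutoff_mul_self ha
  refine (mem_her_iff ha).mpr ⟨?_, ?_⟩
  · have h' := h.mul_const k
    simp only [mul_assoc, ← hk1] at h'
    exact h'
  · have h' := ((mem_her_iff ha).mp (self_mem_her ha)).2
    have h'' := h'.const_mul k
    simp only [← mul_assoc, ← hk2] at h''
    exact h''

/-- The hereditary subalgebra is hereditary. -/
lemma mem_her_of_le {x y : A} (hy : 0 ≤ y) (hx : 0 ≤ x) {C : ℝ} (hxy : x ≤ C • y) :
    x ∈ her y := by
  obtain ⟨s, hs, rfl⟩ : ∃ s : A, IsSelfAdjoint s ∧ x = s * s :=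
    ⟨CFC.sqrt x, .of_nonneg (CFC.sqrt_nonneg x), (CFC.sqrt_mul_sqrt_self x hx).symm⟩
  have hu : ∀ n, IsSelfAdjoint (cutoff n y) := fun n => .of_nonneg (cutoff_nonneg n y)
  have key : Tendsto (fun n => s * cutoff n y) atTop (𝓝 s) := by
    have hyu : Tendsto (fun n => y * cutoff n y) atTop (𝓝 y) :=
      ((mem_her_iff hy).mp (self_mem_her hy)).2
    rw [tendsto_iff_norm_sub_tendsto_zero] at hyu ⊢
    have h2 : Tendsto (fun n => √(|C| * ‖y * cutoff n y - y‖)) atTop (𝓝 0) := by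
      have := (hyu.const_mul |C|).sqrt
      rwa [mul_zero, Real.sqrt_zero] at this
    refine squeeze_zero (fun _ => norm_nonneg _) (fun n => Real.le_sqrt_of_sq_le ?_) h2
    set v := 1 - cutoff n y with hv
    have hvs : star v = v := by simp [hv, (hu n).star_eq]
    have hv0 : 0 ≤ v := sub_nonneg.mpr (cutoff_le_one n y)
    have hv1 : ‖v‖ ≤ 1 := norm_le_one_of_le_one hv0 (sub_le_self _ (cutoff_nonneg n y))
    have e1 : s * cutoff n y - s = -(s * v) := by simp [hv, mul_sub]
    have e2 : y * cutoff n y - y = -(y * v) := by simp [hv, mul_sub]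
    rw [e1, e2, norm_neg, norm_neg, pow_two, ← CStarRing.norm_star_mul_self, star_mul, hvs,
      hs.star_eq]
    have le1 : v * (s * s) * v ≤ v * (C • y) * v := by
      have := star_left_conjugate_le_conjugate hxy v
      rwa [hvs] at this
    have nn : 0 ≤ v * (s * s) * v := by
      have := star_left_conjugate_nonneg hx v
      rwa [hvs] at this
    calc ‖v * s * (s * v)‖ = ‖v * (s * s) * v‖ := by simp [mul_assoc]
      _ ≤ ‖v * (C • y) * v‖ := CStarAlgebra.norm_le_norm_of_nonneg_of_le nn le1
      _ = |C| * ‖v * (y * v)‖ := by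
          rw [mul_smul_comm, smul_mul_assoc, norm_smul, Real.norm_eq_abs, mul_assoc]
      _ ≤ |C| * (1 * ‖y * v‖) := by
          gcongr
          exact (norm_mul_le _ _).trans (by gcongr)
      _ = _ := by rw [one_mul]
  have key' : Tendsto (fun n => cutoff n y * s) atTop (𝓝 s) := by
    simpa [hs.star_eq, (hu _).star_eq] using key.star
  exact (mem_her_iff hy).mpr ⟨by simpa [mul_assoc] using key'.mul_const s,
    by simpa [mul_assoc] using key.const_mul s⟩

end Her

section Orthogonal

lemma sum_range_mul_eq_zero {w : ℕ → A} (horth : ∀ i j, i ≠ j → w i * w j = 0) (N : ℕ) :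
    (∑ i ∈ Finset.range N, w i) * w N = 0 := by
  rw [Finset.sum_mul]
  exact Finset.sum_eq_zero fun i hi => horth i N (Finset.mem_range.mp hi).ne

variable [PartialOrder A] [StarOrderedRing A]

lemma mul_self_le_self {x : A} (h0 : 0 ≤ x) (h1 : x ≤ 1) : x * x ≤ x := by
  obtain ⟨s, hs, rfl⟩ : ∃ s : A, IsSelfAdjoint s ∧ x = s * s :=
    ⟨CFC.sqrt x, .of_nonneg (CFC.sqrt_nonneg x), (CFC.sqrt_mul_sqrt_self x h0).symm⟩
  have := star_left_conjugate_le_conjugate h1 s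
  simpa [hs.star_eq, mul_assoc] using this

lemma add_le_one_of_mul_eq_zero {x y : A} (hx0 : 0 ≤ x) (hx1 : x ≤ 1) (hy0 : 0 ≤ y)
    (hy1 : y ≤ 1) (hxy : x * y = 0) : x + y ≤ 1 := by
  have hyx : y * x = 0 := by
    have := congrArg star hxy
    simpa [(IsSelfAdjoint.of_nonneg hx0).star_eq, (IsSelfAdjoint.of_nonneg hy0).star_eq] using this
  have hs : star (1 - x) = 1 - x := by simp [(IsSelfAdjoint.of_nonneg hx0).star_eq]
  have h1 := star_left_conjugate_le_conjugate hy1 (1 - x)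
  have h2 : (1 - x) * y * (1 - x) = y := by simp [sub_mul, mul_sub, hxy, hyx]
  rw [hs, h2, mul_one] at h1
  have h3 := h1.trans (mul_self_le_self (sub_nonneg.mpr hx1) (sub_le_self _ hx0))
  rwa [le_sub_iff_add_le'] at h3

lemma sum_range_le_one {w : ℕ → A} (h0 : ∀ i, 0 ≤ w i) (h1 : ∀ i, w i ≤ 1)
    (horth : ∀ i j, i ≠ j → w i * w j = 0) (N : ℕ) : ∑ i ∈ Finset.range N, w i ≤ 1 := by
  induction N with
  | zero => simp
  | succ N ih =>
    rw [Finset.sum_range_succ]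
    exact add_le_one_of_mul_eq_zero (Finset.sum_nonneg fun i _ => h0 i) ih (h0 N) (h1 N)
      (sum_range_mul_eq_zero horth N)

lemma cutoff_mul_cutoff_eq_zero {a b : A} (ha : 0 ≤ a) (hb : 0 ≤ b) (hab : a * b = 0) (m n : ℕ) :
    cutoff m a * cutoff n b = 0 :=
  mul_eq_zero_of_mem_her hab (cutoff_mem_her ha m) (cutoff_mem_her hb n)

end Orthogonal

section DTau

variable [PartialOrder A] [StarOrderedRing A] [Nontrivial A] {τ : A →L[ℂ] ℂ}

namespace IsTracialState

lemma bddAbove_cutoff (h : IsTracialState τ) (a : A) :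
    BddAbove (Set.range fun n : ℕ => (τ (cutoff n a)).re) := by
  refine ⟨1, ?_⟩
  rintro _ ⟨n, rfl⟩
  exact h.re_le_one (cutoff_le_one n a)

lemma re_cutoff_le_dTau (h : IsTracialState τ) (a : A) (n : ℕ) :
    (τ (cutoff n a)).re ≤ dTau τ a :=
  le_ciSup (h.bddAbove_cutoff a) n

lemma dTau_nonneg (h : IsTracialState τ) (a : A) : 0 ≤ dTau τ a :=
  (h.re_nonneg (cutoff_nonneg 0 a)).trans (h.re_cutoff_le_dTau a 0)

lemma dTau_le_one (h : IsTracialState τ) (a : A) : dTau τ a ≤ 1 :=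
  ciSup_le fun n => h.re_le_one (cutoff_le_one n a)

lemma monotone_re_cutoff (h : IsTracialState τ) {a : A} (ha : 0 ≤ a) :
    Monotone fun n => (τ (cutoff n a)).re :=
  fun _ _ hmn => h.re_mono (cutoff_mono ha hmn)

lemma tendsto_re_cutoff (h : IsTracialState τ) {a : A} (ha : 0 ≤ a) :
    Tendsto (fun n => (τ (cutoff n a)).re) atTop (𝓝 (dTau τ a)) :=
  tendsto_atTop_ciSup (h.monotone_re_cutoff ha) (h.bddAbove_cutoff a)

/-- An upper bound for the trace on an approximate unit bounds it on positive contractions of the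
hereditary subalgebra. -/
lemma re_le_of_mem_her (h : IsTracialState τ) {a x : A} (ha : IsSelfAdjoint a) {w : ℕ → A}
    (hw0 : ∀ n, 0 ≤ w n) (hw1 : ∀ n, w n ≤ 1) (hwa : Tendsto (fun n => w n * a) atTop (𝓝 a))
    {C : ℝ} (hC : ∀ n, (τ (w n)).re ≤ C) (hx : x ∈ her a) (hx1 : x ≤ 1) : (τ x).re ≤ C := by
  have hws : ∀ n, IsSelfAdjoint (w n) := fun n => .of_nonneg (hw0 n)
  have hwn : ∀ n, ‖w n‖ ≤ 1 := fun n => norm_le_one_of_le_one (hw0 n) (hw1 n)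
  have lim := tendsto_conj hwn (tendsto_mul_of_mem_her hwn hwa hx)
    (tendsto_mul_of_mem_her' ha hws hwn hwa hx)
  have lim' : Tendsto (fun n => (τ (w n * x * w n)).re) atTop (𝓝 (τ x).re) :=
    ((Complex.continuous_re.comp τ.continuous).tendsto x).comp lim
  refine le_of_tendsto' lim' fun n => ?_
  have h1 := star_left_conjugate_le_conjugate hx1 (w n)
  rw [(hws n).star_eq, mul_one] at h1
  exact (h.re_mono (h1.trans (mul_self_le_self (hw0 n) (hw1 n)))).trans (hC n)

lemma re_le_dTau (h : IsTracialState τ) {a x : A} (ha : 0 ≤ a) (hx : x ∈ her a) (hx1 : x ≤ 1) :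
    (τ x).re ≤ dTau τ a :=
  h.re_le_of_mem_her (.of_nonneg ha) (cutoff_nonneg · a) (cutoff_le_one · a)
    (tendsto_cutoff_mul_self ha) (h.re_cutoff_le_dTau a) hx hx1

lemma dTau_mono (h : IsTracialState τ) {a b : A} (ha : 0 ≤ a) (hb : 0 ≤ b) (hab : b ∈ her a) :
    dTau τ b ≤ dTau τ a :=
  ciSup_le fun n => h.re_le_dTau ha (her_subset_her ha hab (cutoff_mem_her hb n))
    (cutoff_le_one n b)

lemma sum_dTau_le_one (h : IsTracialState τ) {b : ℕ → A} (hb : ∀ n, 0 ≤ b n)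
    (horth : ∀ i j, i ≠ j → b i * b j = 0) (N : ℕ) :
    ∑ i ∈ Finset.range N, dTau τ (b i) ≤ 1 := by
  refine le_of_tendsto' (tendsto_finsetSum _ fun i _ => h.tendsto_re_cutoff (hb i)) fun n => ?_
  have := h.re_le_one (sum_range_le_one (fun i => cutoff_nonneg n (b i))
    (fun i => cutoff_le_one n (b i))
    (fun i j hij => cutoff_mul_cutoff_eq_zero (hb i) (hb j) (horth i j hij) n n) N)
  simpa using this

lemma summable_dTau (h : IsTracialState τ) {b : ℕ → A} (hb : ∀ n, 0 ≤ b n)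
    (horth : ∀ i j, i ≠ j → b i * b j = 0) : Summable fun n => dTau τ (b n) :=
  summable_of_sum_range_le (fun n => h.dTau_nonneg (b n)) (h.sum_dTau_le_one hb horth)

lemma dTau_sum_le (h : IsTracialState τ) {b : ℕ → A} (hb : ∀ n, 0 ≤ b n)
    (horth : ∀ i j, i ≠ j → b i * b j = 0) (N : ℕ) :
    dTau τ (∑ i ∈ Finset.range N, b i) ≤ ∑ i ∈ Finset.range N, dTau τ (b i) := by
  have hB : 0 ≤ ∑ i ∈ Finset.range N, b i := Finset.sum_nonneg fun i _ => hb i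
  refine ciSup_le fun k => ?_
  refine h.re_le_of_mem_her (.of_nonneg hB)
    (w := fun n => ∑ i ∈ Finset.range N, cutoff n (b i))
    (fun n => Finset.sum_nonneg fun i _ => cutoff_nonneg n (b i)) (fun n => ?_) ?_ (fun n => ?_)
    (cutoff_mem_her hB k) (cutoff_le_one _ _)
  · exact sum_range_le_one (fun i => cutoff_nonneg n (b i)) (fun i => cutoff_le_one n (b i))
      (fun i j hij => cutoff_mul_cutoff_eq_zero (hb i) (hb j) (horth i j hij) n n) N
  · have h1 : ∀ n, (∑ i ∈ Finset.range N, cutoff n (b i)) * ∑ i ∈ Finset.range N, b i =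
        ∑ i ∈ Finset.range N, cutoff n (b i) * b i := by
      intro n
      rw [Finset.sum_mul]
      refine Finset.sum_congr rfl fun i hi => ?_
      rw [Finset.mul_sum, Finset.sum_eq_single_of_mem i hi]
      exact fun j _ hji => mul_eq_zero_of_mem_her (horth i j hji.symm) (cutoff_mem_her (hb i) n)
        (self_mem_her (hb j))
    simp only [h1]
    exact tendsto_finsetSum _ fun i _ => tendsto_cutoff_mul_self (hb i)
  · simpa using Finset.sum_le_sum fun i _ => h.re_cutoff_le_dTau (b i) n

/-- Cutting `a` down by `1 - f(c)` loses at most the rank of `c`. -/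
lemma dTau_le_add (h : IsTracialState τ) {a c : A} (ha : 0 ≤ a) (hc : 0 ≤ c) (k : ℕ) :
    dTau τ a ≤ dTau τ c + dTau τ ((1 - cutoff k c) * a * (1 - cutoff k c)) := by
  set g := cutoff k c with hg
  set v := 1 - g with hv
  have hv0 : 0 ≤ v := sub_nonneg.mpr (cutoff_le_one k c)
  have hv1 : v ≤ 1 := sub_le_self _ (cutoff_nonneg k c)
  have hvs : star v = v := (IsSelfAdjoint.of_nonneg hv0).star_eq
  have conj_nonneg : ∀ {x : A}, 0 ≤ x → 0 ≤ v * x * v := by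
    intro x hx
    have := star_left_conjugate_nonneg hx v
    rwa [hvs] at this
  have conj_mono : ∀ {x y : A}, x ≤ y → v * x * v ≤ v * y * v := by
    intro x y hxy
    have := star_left_conjugate_le_conjugate hxy v
    rwa [hvs] at this
  have ha' : 0 ≤ v * a * v := conj_nonneg ha
  refine ciSup_le fun n => ?_
  change (τ (cutoff n a)).re ≤ _
  have hu0 := cutoff_nonneg n a
  have hu1 := cutoff_le_one n a
  have hmem : v * cutoff n a * v ∈ her (v * a * v) := by
    refine mem_her_of_le ha' (conj_nonneg hu0) (C := n + 1) ?_
    have := conj_mono (cutoff_le_smul ha n)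
    rwa [mul_smul_comm, smul_mul_assoc] at this
  have h1 : (τ (v * cutoff n a * v)).re ≤ dTau τ (v * a * v) := by
    refine h.re_le_dTau ha' hmem ((conj_mono hu1).trans ?_)
    rw [mul_one]
    exact (mul_self_le_self hv0 hv1).trans hv1
  have hg' : 0 ≤ 1 - v * v := sub_nonneg.mpr ((mul_self_le_self hv0 hv1).trans hv1)
  have h2 : (τ (1 - v * v)).re ≤ dTau τ c := by
    refine h.re_le_dTau hc ?_ (sub_le_self _ ?_)
    · have : 1 - v * v = g + g - g * 1 * g := by rw [hv]; noncomm_ring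
      rw [this]
      have hgm := cutoff_mem_her hc k
      exact sub_mem_her hc (add_mem_her hc hgm hgm) (mul_mem_her hc hgm 1 hgm)
    · simpa using conj_nonneg zero_le_one
  have h3 : (τ ((1 - v * v) * cutoff n a)).re ≤ (τ (1 - v * v)).re := by
    simpa using h.re_mul_mono hg' hu1
  have h4 : τ (cutoff n a) = τ ((1 - v * v) * cutoff n a) + τ (v * cutoff n a * v) := by
    rw [h.2.2 (v * cutoff n a) v, ← map_add]
    congr 1
    noncomm_ring
  rw [h4, Complex.add_re]
  linarith

end IsTracialState

end DTau

section Osc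

variable [PartialOrder A] [StarOrderedRing A] [Nontrivial A]

lemma osc_term_nonneg (a : A) (n : ℕ) (τ : ↥(traceSet A)) :
    0 ≤ dTau (τ : A →L[ℂ] ℂ) a - ((τ : A →L[ℂ] ℂ) (cutoff n a)).re :=
  sub_nonneg.mpr (τ.2.re_cutoff_le_dTau a n)

lemma bddAbove_osc_term (a : A) (n : ℕ) : BddAbove (Set.range fun τ : ↥(traceSet A) =>
    dTau (τ : A →L[ℂ] ℂ) a - ((τ : A →L[ℂ] ℂ) (cutoff n a)).re) := by
  refine ⟨1, ?_⟩
  rintro _ ⟨τ, rfl⟩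
  have h1 := τ.2.dTau_le_one a
  have h2 := τ.2.re_nonneg (cutoff_nonneg n a)
  simp only
  linarith

lemma osc_nonneg (a : A) : 0 ≤ osc a :=
  Real.iInf_nonneg fun n => Real.iSup_nonneg (osc_term_nonneg a n)

lemma exists_cutoff_of_osc_lt {a : A} {η : ℝ} (h : osc a < η) :
    ∃ n, ∀ τ : A →L[ℂ] ℂ, IsTracialState τ → dTau τ a - (τ (cutoff n a)).re < η := by
  obtain ⟨n, hn⟩ := exists_lt_of_ciInf_lt h
  exact ⟨n, fun τ hτ => (le_ciSup (bddAbove_osc_term a n) (⟨τ, hτ⟩ : ↥(traceSet A))).trans_lt hn⟩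

/-- The oscillation can be estimated with any positive contraction of the hereditary
subalgebra. -/
lemma osc_le (hT : (traceSet A).Nonempty) {a x : A} (ha : 0 ≤ a) (hx : x ∈ her a)
    (hx1 : x ≤ 1) {C : ℝ}
    (hC : ∀ τ : A →L[ℂ] ℂ, IsTracialState τ → dTau τ a - (τ x).re ≤ C) : osc a ≤ C := by
  have : Nonempty ↥(traceSet A) := hT.to_subtype
  refine le_of_forall_pos_le_add fun δ hδ => ?_
  obtain ⟨l1, l2⟩ := (mem_her_iff ha).mp hx
  obtain ⟨n, hn⟩ := (Metric.tendsto_atTop.mp (tendsto_conj (norm_cutoff_le_one · a) l1 l2) δ hδ)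
  have hn := hn n le_rfl
  refine ciInf_le_of_le ⟨0, ?_⟩ n (ciSup_le fun τ => ?_)
  · rintro _ ⟨m, rfl⟩
    exact Real.iSup_nonneg (osc_term_nonneg a m)
  · have h1 := star_left_conjugate_le_conjugate hx1 (cutoff n a)
    rw [(IsSelfAdjoint.of_nonneg (cutoff_nonneg n a)).star_eq, mul_one] at h1
    have h2 := τ.2.re_mono (h1.trans (mul_self_le_self (cutoff_nonneg n a) (cutoff_le_one n a)))
    have h3 := τ.2.re_le_norm (x - cutoff n a * x * cutoff n a)
    rw [← dist_eq_norm, dist_comm, map_sub, Complex.sub_re] at h3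
    have h4 := hC τ τ.2
    change dTau (τ : A →L[ℂ] ℂ) a - ((τ : A →L[ℂ] ℂ) (cutoff n a)).re ≤ _
    linarith

/-- An element with small oscillation can be replaced by a cutoff. -/
lemma exists_cutoff_osc_le (hT : (traceSet A).Nonempty) {a : A} (ha : 0 ≤ a) {η : ℝ}
    (h : osc a < η) : ∃ n, osc (cutoff n a) ≤ η ∧
      ∀ τ : A →L[ℂ] ℂ, IsTracialState τ → dTau τ a - (τ (cutoff n a)).re < η := by
  obtain ⟨n, hn⟩ := exists_cutoff_of_osc_lt h
  refine ⟨n, osc_le hT (cutoff_nonneg n a) (self_mem_her (cutoff_nonneg n a)) (cutoff_le_one n a)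
    fun τ hτ => ?_, hn⟩
  have := hτ.dTau_mono ha (cutoff_nonneg n a) (cutoff_mem_her ha n)
  linarith [hn τ hτ]

end Osc

section Decomposition

lemma IsTracialState.re_star_mul_self_le_norm2 {τ : A →L[ℂ] ℂ} (h : IsTracialState τ) (x : A) :
    √((τ (star x * x)).re) ≤ norm2 x := by
  refine le_ciSup (f := fun τ : ↥(traceSet A) => √(((τ : A →L[ℂ] ℂ) (star x * x)).re))
    ⟨√‖star x * x‖, ?_⟩ ⟨τ, h⟩
  rintro _ ⟨σ, rfl⟩
  exact Real.sqrt_le_sqrt (σ.2.re_le_norm _)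

variable [PartialOrder A] [StarOrderedRing A] [Nontrivial A]

lemma hasSum_const_mul_geometric_two (η : ℝ) : HasSum (fun n : ℕ => η * (1 / 2) ^ n) (η * 2) :=
  hasSum_geometric_two.mul_left η

/-- An orthogonal sequence exhausting `e` in rank can be cut down to one exhausting `e` in
trace. -/
lemma exists_seq_trace_of_seq_rank (hT : (traceSet A).Nonempty) {e : A} (he : 0 ≤ e) {ε : ℝ}
    (hε : 0 < ε) {b : ℕ → A} (hmem : ∀ n, b n ∈ her e) (h0 : ∀ n, 0 ≤ b n)
    (horth : ∀ n m, n ≠ m → b n * b m = 0) (hsum : Summable fun n => osc (b n))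
    (hosc : (∑' n, osc (b n)) < ε / 4)
    (hd : ∀ τ : A →L[ℂ] ℂ, IsTracialState τ → dTau τ e - (∑' n, dTau τ (b n)) < ε / 4) :
    ∃ c : ℕ → A, (∀ n, c n ∈ her e) ∧ (∀ n, 0 ≤ c n) ∧ (∀ n, ‖c n‖ ≤ 1) ∧
      (∀ n m, n ≠ m → c n * c m = 0) ∧
      (Summable fun n => osc (c n)) ∧ (∑' n, osc (c n)) < ε ∧
      ∀ τ : A →L[ℂ] ℂ, IsTracialState τ →
        (Summable fun n => (τ (c n)).re) ∧ dTau τ e - (∑' n, (τ (c n)).re) < ε := by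
  have hgeo := hasSum_const_mul_geometric_two (ε / 8)
  have hη : ∀ n : ℕ, osc (b n) < osc (b n) + ε / 8 * (1 / 2) ^ n := fun n =>
    lt_add_of_pos_right _ (by positivity)
  choose k hk1 hk2 using fun n => exists_cutoff_osc_le hT (h0 n) (hη n)
  have hS := hsum.add hgeo.summable
  have hS' : ∑' n, (osc (b n) + ε / 8 * (1 / 2) ^ n) < ε / 2 := by
    rw [hsum.tsum_add hgeo.summable, hgeo.tsum_eq]
    linarith
  have hcs : Summable fun n => osc (cutoff (k n) (b n)) :=
    Summable.of_nonneg_of_le (fun n => osc_nonneg _) hk1 hS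
  refine ⟨fun n => cutoff (k n) (b n),
    fun n => her_subset_her he (hmem n) (cutoff_mem_her (h0 n) _), fun n => cutoff_nonneg _ _,
    fun n => norm_cutoff_le_one _ _,
    fun n m hnm => cutoff_mul_cutoff_eq_zero (h0 n) (h0 m) (horth n m hnm) _ _, hcs, ?_,
    fun τ hτ => ?_⟩
  · have := hcs.tsum_le_tsum hk1 hS
    linarith
  · have hds := hτ.summable_dTau h0 horth
    have hts : Summable fun n => (τ (cutoff (k n) (b n))).re :=
      Summable.of_nonneg_of_le (fun n => hτ.re_nonneg (cutoff_nonneg _ _))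
        (fun n => hτ.re_cutoff_le_dTau _ _) hds
    refine ⟨hts, ?_⟩
    have h1 : ∑' n, (dTau τ (b n) - (τ (cutoff (k n) (b n))).re) ≤
        ∑' n, (osc (b n) + ε / 8 * (1 / 2) ^ n) :=
      (hds.sub hts).tsum_le_tsum (fun n => (hk2 n τ hτ).le) hS
    rw [hds.tsum_sub hts] at h1
    linarith [hd τ hτ]

lemma IsTracialState.re_le_norm2 {τ : A →L[ℂ] ℂ} (h : IsTracialState τ) {x : A}
    (hx : IsSelfAdjoint x) : (τ x).re ≤ norm2 x :=
  (Real.le_sqrt_of_sq_le (h.sq_re_le hx)).trans (h.re_star_mul_self_le_norm2 x)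

/-- One step of the exhaustion: split off from the remainder `E` an element `b` of small
oscillation which captures most of the trace of `f_{1/(n+1)}(e)`, and pass to a remainder
orthogonal to `b`. -/
lemma exists_split (hT : (traceSet A).Nonempty) (hA : ∀ a : A, 0 ≤ a → TAOZero a) (e E B : A)
    (s η : ℝ) (n : ℕ) (hE : 0 ≤ E) (hη : 0 < η)
    (hinv : ∀ τ : A →L[ℂ] ℂ, IsTracialState τ → dTau τ e ≤ (τ B).re + dTau τ E + s) :
    ∃ b E' : A, 0 ≤ b ∧ ‖b‖ ≤ 1 ∧ b ∈ her E ∧ osc b ≤ η ∧ 0 ≤ E' ∧ E' ∈ her E ∧ E' * b = 0 ∧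
      ∀ τ : A →L[ℂ] ℂ, IsTracialState τ →
        (τ (cutoff n e)).re ≤ (τ (B + b)).re + (s + 4 * η) ∧
        dTau τ e ≤ (τ (B + b)).re + dTau τ E' + (s + 4 * η) := by
  obtain ⟨k, hk⟩ := exists_forall_re_pos_of_monotone
    (fun k => B + cutoff k E + (s + η) • (1 : A) - cutoff n e)
    (fun τ hτ i j hij => by
      have := hτ.monotone_re_cutoff hE hij
      simp only [map_add, map_sub, Complex.add_re, Complex.sub_re] at this ⊢
      linarith)
    (fun τ hτ => by
      have h1 := hinv τ hτ
      have h2 := hτ.re_cutoff_le_dTau e n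
      obtain ⟨k, hk⟩ := exists_lt_of_lt_ciSup (sub_lt_self (dTau τ E) hη)
      refine ⟨k, ?_⟩
      simp only [map_add, map_sub, Complex.add_re, Complex.sub_re, IsTracialState.re_smul,
        hτ.re_one]
      change _ < (τ (cutoff k E)).re at hk
      linarith)
  obtain ⟨c, hc, hc0, hc1, hcn, hco⟩ := hA (cutoff k E) (cutoff_nonneg k E) η hη
  have hcE : c ∈ her E := her_subset_her hE (cutoff_mem_her hE k) hc
  have hc1' : c ≤ 1 :=
    (CStarAlgebra.norm_le_one_iff_of_nonneg c).mp (hc1.trans (norm_cutoff_le_one k E))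
  obtain ⟨m, hm1, hm2⟩ := exists_cutoff_osc_le hT hc0 hco
  set g := cutoff (2 * m + 1) c with hg
  have hgE : g ∈ her E := her_subset_her hE hcE (cutoff_mem_her hc0 _)
  have hgs : star (1 - g) = 1 - g := by
    rw [star_sub, star_one, (IsSelfAdjoint.of_nonneg (cutoff_nonneg _ c)).star_eq]
  have hEm := self_mem_her hE
  refine ⟨cutoff m c, (1 - g) * E * (1 - g), cutoff_nonneg m c, norm_cutoff_le_one m c,
    her_subset_her hE hcE (cutoff_mem_her hc0 m), hm1, ?_, ?_, ?_, fun τ hτ => ?_⟩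
  · have := star_left_conjugate_nonneg hE (1 - g)
    rwa [hgs] at this
  · have : (1 - g) * E * (1 - g) = E - g * 1 * E - E * 1 * g + g * E * g := by noncomm_ring
    rw [this]
    exact add_mem_her hE (sub_mem_her hE (sub_mem_her hE hEm (mul_mem_her hE hgE 1 hEm))
      (mul_mem_her hE hEm 1 hgE)) (mul_mem_her hE hgE E hgE)
  · have : (1 - g) * cutoff m c = 0 := by rw [sub_mul, one_mul, hg, cutoff_mul_cutoff, sub_self]
    rw [mul_assoc, this, mul_zero]
  · have h1 := hk τ hτ
    simp only [map_add, map_sub, Complex.add_re, Complex.sub_re, IsTracialState.re_smul,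
      hτ.re_one] at h1 ⊢
    have h2 := hτ.re_le_norm2 ((IsSelfAdjoint.of_nonneg (cutoff_nonneg k E)).sub (.of_nonneg hc0))
    rw [map_sub, Complex.sub_re] at h2
    have h3 := hτ.re_le_dTau hc0 (self_mem_her hc0) hc1'
    have h4 := hm2 τ hτ
    have h5 := hinv τ hτ
    have h6 := hτ.dTau_le_add hE hc0 (2 * m + 1)
    constructor <;> linarith

/-- If all positive elements have tracial approximate oscillation zero, then every positive
element is exhausted in trace by an orthogonal sequence of small total oscillation. -/
lemma exists_seq_trace_of_taoZero (hT : (traceSet A).Nonempty)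
    (hA : ∀ a : A, 0 ≤ a → TAOZero a) {e : A} (he : 0 ≤ e) {ε : ℝ} (hε : 0 < ε) :
    ∃ b : ℕ → A, (∀ n, b n ∈ her e) ∧ (∀ n, 0 ≤ b n) ∧ (∀ n, ‖b n‖ ≤ 1) ∧
      (∀ n m, n ≠ m → b n * b m = 0) ∧
      (Summable fun n => osc (b n)) ∧ (∑' n, osc (b n)) < ε ∧
      ∀ τ : A →L[ℂ] ℂ, IsTracialState τ →
        (Summable fun n => (τ (b n)).re) ∧ dTau τ e - (∑' n, (τ (b n)).re) < ε := by
  let η : ℕ → ℝ := fun n => ε / 16 * (1 / 2) ^ n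
  let s : ℕ → ℝ := fun n => ε / 2 * (1 - (1 / 2) ^ n)
  have hη : ∀ n, 0 < η n := fun n => by positivity
  have hs : ∀ n, s (n + 1) = s n + 4 * η n := fun n => by
    simp only [s, η, pow_succ]
    ring
  have hs' : ∀ n, s n ≤ ε / 2 := fun n => by
    have : (0 : ℝ) ≤ (1 / 2) ^ n := by positivity
    simp only [s]
    nlinarith
  choose! β R hβ using fun (n : ℕ) (p : A × A) (hp : 0 ≤ p.1 ∧ ∀ τ : A →L[ℂ] ℂ,
      IsTracialState τ → dTau τ e ≤ (τ p.2).re + dTau τ p.1 + s n) =>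
    exists_split hT hA e p.1 p.2 (s n) (η n) n hp.1 (hη n) hp.2
  let St : ℕ → A × A := fun n => Nat.rec (e, 0) (fun n p => (R n p, p.2 + β n p)) n
  have hSt : ∀ n, 0 ≤ (St n).1 ∧ ∀ τ : A →L[ℂ] ℂ,
      IsTracialState τ → dTau τ e ≤ (τ (St n).2).re + dTau τ (St n).1 + s n := by
    intro n
    induction n with
    | zero => exact ⟨he, fun τ _ => by simp [St, s]⟩
    | succ n ih =>
      obtain ⟨-, -, -, -, h1, -, -, h2⟩ := hβ n (St n) ih
      refine ⟨h1, fun τ hτ => ?_⟩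
      rw [hs]
      exact (h2 τ hτ).2
  let b : ℕ → A := fun n => β n (St n)
  have hb := fun n => hβ n (St n) (hSt n)
  have h0 : ∀ n, 0 ≤ b n := fun n => (hb n).1
  have h1 : ∀ n, ‖b n‖ ≤ 1 := fun n => (hb n).2.1
  have hsub : ∀ n k, her (St (n + k)).1 ⊆ her (St n).1 := by
    intro n k
    induction k with
    | zero => exact subset_rfl
    | succ k ih => exact (her_subset_her (hSt (n + k)).1 (hb (n + k)).2.2.2.2.2.1).trans ih
  have hSb : ∀ n, (St n).2 = ∑ i ∈ Finset.range n, b i := by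
    intro n
    induction n with
    | zero => simp [St]
    | succ n ih => rw [Finset.sum_range_succ, ← ih]
  have hlt : ∀ n m, m < n → b n * b m = 0 := by
    intro n m hmn
    obtain ⟨k, rfl⟩ := Nat.exists_eq_add_of_lt hmn
    have h3 : b (m + k + 1) ∈ her (St (m + 1)).1 := by
      have := hsub (m + 1) k (a := b (m + 1 + k)) (hb (m + 1 + k)).2.2.1
      rwa [show m + k + 1 = m + 1 + k by ring]
    exact mul_eq_zero_of_mem_her (hb m).2.2.2.2.2.2.1 h3 (self_mem_her (h0 m))
  have horth : ∀ n m, n ≠ m → b n * b m = 0 := by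
    intro n m hnm
    rcases lt_or_gt_of_ne hnm with h | h
    · have := congrArg star (hlt m n h)
      simpa [(IsSelfAdjoint.of_nonneg (h0 _)).star_eq] using this
    · exact hlt n m h
  have hgeo := hasSum_const_mul_geometric_two (ε / 16)
  have hosum : Summable fun n => osc (b n) :=
    Summable.of_nonneg_of_le (fun n => osc_nonneg _) (fun n => (hb n).2.2.2.1) hgeo.summable
  refine ⟨b, fun n => ?_, h0, h1, horth, hosum, ?_, fun τ hτ => ?_⟩
  · have := hsub 0 n (a := b n)
    rw [zero_add] at this
    exact this (hb n).2.2.1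
  · have := hosum.tsum_le_tsum (fun n => (hb n).2.2.2.1) hgeo.summable
    rw [hgeo.tsum_eq] at this
    linarith
  · have hτ0 : ∀ n, 0 ≤ (τ (b n)).re := fun n => hτ.re_nonneg (h0 n)
    have hτs : Summable fun n => (τ (b n)).re :=
      Summable.of_nonneg_of_le hτ0 (fun n => hτ.re_le_dTau (h0 n) (self_mem_her (h0 n))
        ((CStarAlgebra.norm_le_one_iff_of_nonneg _).mp (h1 n))) (hτ.summable_dTau h0 horth)
    refine ⟨hτs, ?_⟩
    have : dTau τ e ≤ ∑' n, (τ (b n)).re + ε / 2 := by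
      refine ciSup_le fun n => ?_
      have h4 := ((hb n).2.2.2.2.2.2.2 τ hτ).1
      have h5 : (St n).2 + β n (St n) = ∑ i ∈ Finset.range (n + 1), b i := by
        rw [Finset.sum_range_succ, ← hSb]
      rw [h5, map_sum, Complex.re_sum, ← hs] at h4
      have h6 := hτs.sum_le_tsum (Finset.range (n + 1)) fun i _ => hτ0 i
      change (τ (cutoff n e)).re ≤ _
      linarith [hs' (n + 1)]
    linarith

end Decomposition

section Approximation

variable [PartialOrder A] [StarOrderedRing A] [Nontrivial A] {τ : A →L[ℂ] ℂ}

lemma mul_cutoff_mul_le {a : A} (ha : 0 ≤ a) (n : ℕ) :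
    a * cutoff n a * a ≤ (‖a‖ ^ 2) • cutoff n a := by
  have hf := continuous_fE (1 / (n + 1 : ℝ))
  have h1 : a * cutoff n a * a = cfc (fun t => t * fE (1 / (n + 1 : ℝ)) t * t) a := by
    rw [cfc_mul _ _ a (by fun_prop) (by fun_prop), cfc_mul _ _ a (by fun_prop) (by fun_prop),
      cfc_id' ℝ a]
  rw [h1, cutoff, ← cfc_smul _ _ a (by fun_prop)]
  refine cfc_mono (fun t ht => ?_) (by fun_prop) (by fun_prop)
  have h2 := spectrum_real_nonneg ha ht
  have h3 : t ≤ ‖a‖ := (Real.le_norm_self t).trans (spectrum.norm_le_norm_of_mem ht)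
  have h4 := fE_nonneg (1 / (n + 1 : ℝ)) t
  rw [smul_eq_mul]
  nlinarith [mul_le_mul_of_nonneg_right (pow_le_pow_left₀ h2 h3 2) h4]

namespace IsTracialState

lemma re_mul_one_sub_mul_le (h : IsTracialState τ) {a B : A} (ha : 0 ≤ a) (hB : B ∈ her a)
    (hB1 : B ≤ 1) : (τ (a * (1 - B) * a)).re ≤ ‖a‖ ^ 2 * (dTau τ a - (τ B).re) := by
  have hcut := tendsto_cutoff_mul_self ha
  have hre : Continuous fun x : A => (τ x).re := Complex.continuous_re.comp τ.continuous
  have h1 : Tendsto (fun n => (τ ((1 - B) * (a * (cutoff n a * a)))).re) atTop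
      (𝓝 (τ ((1 - B) * (a * a))).re) :=
    (hre.tendsto _).comp ((hcut.const_mul a).const_mul (1 - B))
  have h2 : Tendsto (fun n => ‖a‖ ^ 2 * ((τ (cutoff n a)).re - (τ (B * cutoff n a)).re)) atTop
      (𝓝 (‖a‖ ^ 2 * (dTau τ a - (τ B).re))) :=
    ((h.tendsto_re_cutoff ha).sub
      ((hre.tendsto _).comp ((mem_her_iff ha).mp hB).2)).const_mul _
  rw [mul_assoc, h.2.2 a, mul_assoc]
  refine le_of_tendsto_of_tendsto' h1 h2 fun n => ?_
  have h3 := h.re_mul_mono (sub_nonneg.mpr hB1) (mul_cutoff_mul_le ha n)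
  rw [mul_smul_comm, re_smul, sub_mul 1 B (cutoff n a), one_mul, map_sub, Complex.sub_re] at h3
  rwa [← mul_assoc a]

lemma re_star_mul_self_add_three_le (h : IsTracialState τ) (x y z : A) :
    (τ (star (x + y + z) * (x + y + z))).re ≤
      3 * ((τ (star x * x)).re + (τ (star y * y)).re + (τ (star z * z)).re) := by
  have h1 := h.re_nonneg (star_mul_self_nonneg (x - y))
  have h2 := h.re_nonneg (star_mul_self_nonneg (y - z))
  have h3 := h.re_nonneg (star_mul_self_nonneg (x - z))
  simp only [star_add, star_sub, add_mul, mul_add, sub_mul, mul_sub, map_add, map_sub,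
    Complex.add_re, Complex.sub_re] at *
  linarith

lemma re_star_mul_self_sub_conj_le (h : IsTracialState τ) {a a' s : A} (ha : IsSelfAdjoint a)
    (hs0 : 0 ≤ s) (hs1 : s ≤ 1) {η : ℝ} (hη : ‖a - a'‖ ≤ η) :
    (τ (star (a - s * a' * s) * (a - s * a' * s))).re ≤
      3 * (2 * (τ (a * (1 - s * s) * a)).re + η ^ 2) := by
  have hs : IsSelfAdjoint s := .of_nonneg hs0
  have hss := mul_self_le_self hs0 hs1
  have hr : star (1 - s) = 1 - s := by rw [star_sub, star_one, hs.star_eq]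
  have hv : (1 - s) * (1 - s) ≤ 1 - s * s := by
    have : 1 - s * s - (1 - s) * (1 - s) = (s - s * s) + (s - s * s) := by noncomm_ring
    rw [← sub_nonneg, this]
    exact add_nonneg (sub_nonneg.mpr hss) (sub_nonneg.mpr hss)
  have hx : (τ (star ((1 - s) * a) * ((1 - s) * a))).re ≤ (τ (a * (1 - s * s) * a)).re := by
    have := h.re_mono (star_left_conjugate_le_conjugate hv a)
    simpa [star_mul, hr, ha.star_eq, mul_assoc] using this
  have hy : (τ (star (s * a * (1 - s)) * (s * a * (1 - s)))).re ≤
      (τ (a * (1 - s * s) * a)).re := by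
    refine le_trans ?_ hx
    have h1 := h.re_mono (star_left_conjugate_le_conjugate (hss.trans hs1) (a * (1 - s)))
    have h2 := h.2.2 ((1 - s) * a) (a * (1 - s))
    simp only [star_mul, hr, ha.star_eq, hs.star_eq, mul_one, mul_assoc] at h1 h2 ⊢
    rwa [h2] at h1
  have hz : (τ (star (s * (a - a') * s) * (s * (a - a') * s))).re ≤ η ^ 2 := by
    have hs' := norm_le_one_of_le_one hs0 hs1
    have h1 : ‖s * (a - a') * s‖ ≤ η := by
      calc ‖s * (a - a') * s‖ ≤ ‖s‖ * ‖a - a'‖ * ‖s‖ := norm_mul₃_le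
        _ ≤ 1 * ‖a - a'‖ * 1 := by gcongr
        _ ≤ η := by linarith
    refine (h.re_le_norm _).trans ?_
    rw [CStarRing.norm_star_mul_self, ← sq]
    gcongr
  have hsplit : a - s * a' * s = (1 - s) * a + s * a * (1 - s) + s * (a - a') * s := by
    noncomm_ring
  rw [hsplit]
  refine (h.re_star_mul_self_add_three_le _ _ _).trans ?_
  linarith

end IsTracialState

/-- An element generating the same hereditary subalgebra as a finite orthogonal sum has oscillation
at most the total oscillation of the summands. -/
lemma osc_le_sum (hT : (traceSet A).Nonempty) {b : ℕ → A} (hb : ∀ n, 0 ≤ b n)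
    (horth : ∀ i j, i ≠ j → b i * b j = 0) {N : ℕ} {c : A} (hc : 0 ≤ c)
    (hcb : c ∈ her (∑ i ∈ Finset.range N, b i)) (hbc : ∑ i ∈ Finset.range N, b i ∈ her c)
    {δ : ℕ → ℝ} (hδ : ∀ n, osc (b n) < δ n) : osc c ≤ ∑ i ∈ Finset.range N, δ i := by
  choose k hk using fun n => exists_cutoff_of_osc_lt (hδ n)
  have hB : 0 ≤ ∑ i ∈ Finset.range N, b i := Finset.sum_nonneg fun i _ => hb i
  refine osc_le hT hc (x := ∑ i ∈ Finset.range N, cutoff (k i) (b i))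
    (sum_mem_her _ hc fun i hi => ?_) (sum_range_le_one (fun i => cutoff_nonneg _ _)
      (fun i => cutoff_le_one _ _)
      (fun i j hij => cutoff_mul_cutoff_eq_zero (hb i) (hb j) (horth i j hij) _ _) N)
    fun τ hτ => ?_
  · refine her_subset_her hc hbc (her_subset_her hB (mem_her_of_le hB (hb i) (C := 1) ?_)
      (cutoff_mem_her (hb i) _))
    rw [one_smul]
    exact Finset.single_le_sum (fun j _ => hb j) hi
  · have h1 := (hτ.dTau_mono hB hc hcb).trans (hτ.dTau_sum_le hb horth N)
    have h2 := Finset.sum_le_sum fun i (_ : i ∈ Finset.range N) => (hk i τ hτ).le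
    rw [Finset.sum_sub_distrib] at h2
    rw [map_sum, Complex.re_sum]
    linarith

lemma taoZero_zero (hT : (traceSet A).Nonempty) : TAOZero (0 : A) := by
  intro ε hε
  refine ⟨0, self_mem_her le_rfl, le_rfl, le_rfl, ?_, ?_⟩
  · have : norm2 (0 - 0 : A) ≤ 0 := Real.iSup_le (fun τ => by simp) le_rfl
    exact this.trans_lt hε
  · refine (osc_le hT le_rfl (self_mem_her le_rfl) zero_le_one fun τ hτ => ?_).trans_lt hε
    rw [map_zero, Complex.zero_re, sub_zero]
    exact ciSup_le fun n => by simpa using hτ.re_mono (cutoff_le_smul (le_refl (0 : A)) n)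

/-- An element exhausted in trace by orthogonal sequences of small total oscillation has tracial
approximate oscillation zero. -/
lemma taoZero_of_exists_seq (hT : (traceSet A).Nonempty) {a : A} (ha : 0 ≤ a)
    (hA : ∀ ε : ℝ, 0 < ε → ∃ b : ℕ → A,
      (∀ n, b n ∈ her a) ∧ (∀ n, 0 ≤ b n) ∧ (∀ n, ‖b n‖ ≤ 1) ∧
      (∀ n m, n ≠ m → b n * b m = 0) ∧
      (Summable fun n => osc (b n)) ∧ (∑' n, osc (b n)) < ε ∧
      ∀ τ : A →L[ℂ] ℂ, IsTracialState τ →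
        (Summable fun n => (τ (b n)).re) ∧ dTau τ a - (∑' n, (τ (b n)).re) < ε) :
    TAOZero a := by
  rcases eq_or_ne a 0 with rfl | ha0
  · exact taoZero_zero hT
  intro ε hε
  have hM : 0 < ‖a‖ := norm_pos_iff.mpr ha0
  obtain ⟨b, hba, hb0, hb1, horth, hosum, hos, hτb⟩ :=
    hA (min (ε / 2) (ε ^ 2 / (72 * ‖a‖ ^ 2))) (by positivity)
  have hb1' : ∀ n, b n ≤ 1 := fun n =>
    (CStarAlgebra.norm_le_one_iff_of_nonneg (b n)).mp (hb1 n)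
  let B : ℕ → A := fun N => ∑ i ∈ Finset.range N, b i
  have hB0 : ∀ N, 0 ≤ B N := fun N => Finset.sum_nonneg fun i _ => hb0 i
  have hB1 : ∀ N, B N ≤ 1 := sum_range_le_one hb0 hb1' horth
  have hBa : ∀ N, B N ∈ her a := fun N => sum_mem_her _ ha fun i _ => hba i
  obtain ⟨N, hN⟩ := exists_forall_re_pos_of_monotone
    (fun N => (ε ^ 2 / 72) • (1 : A) - a * (1 - B N) * a)
    (fun τ hτ i j hij => by
      have h1 : B i ≤ B j := Finset.sum_le_sum_of_subset_of_nonneg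
        (Finset.range_subset_range.mpr hij) fun k _ _ => hb0 k
      have h2 := hτ.re_mono (star_left_conjugate_le_conjugate (sub_le_sub_left h1 1) a)
      rw [(IsSelfAdjoint.of_nonneg ha).star_eq] at h2
      simp only [map_sub, Complex.sub_re]
      linarith)
    (fun τ hτ => by
      obtain ⟨h1, h2⟩ := hτb τ hτ
      have h3 : dTau τ a - ε ^ 2 / (72 * ‖a‖ ^ 2) < ∑' n, (τ (b n)).re := by
        have := h2.trans_le (min_le_right _ _)
        linarith
      obtain ⟨N, hN⟩ := (h1.hasSum.tendsto_sum_nat.eventually (lt_mem_nhds h3)).exists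
      refine ⟨N, ?_⟩
      have h4 := hτ.re_mul_one_sub_mul_le ha (hBa N) (hB1 N)
      have h5 : (τ (B N)).re = ∑ i ∈ Finset.range N, (τ (b i)).re := by
        rw [map_sum, Complex.re_sum]
      have h6 : ‖a‖ ^ 2 * (dTau τ a - (τ (B N)).re) < ‖a‖ ^ 2 * (ε ^ 2 / (72 * ‖a‖ ^ 2)) := by
        gcongr
        linarith
      have h7 : ‖a‖ ^ 2 * (ε ^ 2 / (72 * ‖a‖ ^ 2)) = ε ^ 2 / 72 := by field_simp
      simp only [map_sub, Complex.sub_re, IsTracialState.re_smul, hτ.re_one]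
      linarith)
  let η : ℝ := min ‖a‖ (ε / 6)
  have hη : 0 < η := lt_min hM (by positivity)
  let a' : A := cfc (fun t : ℝ => max t η) a
  let s : A := CFC.sqrt (B N)
  have hs0 : 0 ≤ s := CFC.sqrt_nonneg _
  have hss : s * s = B N := CFC.sqrt_mul_sqrt_self _ (hB0 N)
  have hsa : IsSelfAdjoint s := .of_nonneg hs0
  have hsn : ‖s‖ ≤ 1 := by
    have h1 := norm_le_one_of_le_one (hB0 N) (hB1 N)
    rw [← hss, hsa.norm_mul_self] at h1
    exact (sq_le_one_iff₀ (norm_nonneg _)).mp h1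
  have hs1 : s ≤ 1 := (CStarAlgebra.norm_le_one_iff_of_nonneg s).mp hsn
  have hsp : ∀ t ∈ spectrum ℝ a, t ≤ ‖a‖ := fun t ht =>
    (Real.le_norm_self t).trans (spectrum.norm_le_norm_of_mem ht)
  have ha'l : η • (1 : A) ≤ a' := by
    rw [← Algebra.algebraMap_eq_smul_one]
    exact algebraMap_le_cfc _ _ a (fun t _ => le_max_right _ _) (by fun_prop)
  have ha'u : a' ≤ ‖a‖ • (1 : A) := by
    rw [← Algebra.algebraMap_eq_smul_one]
    exact cfc_le_algebraMap _ _ a (fun t ht => max_le (hsp t ht) (min_le_left _ _)) (by fun_prop)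
  have ha'0 : 0 ≤ a' := cfc_nonneg fun t _ => hη.le.trans (le_max_right _ _)
  have haa' : ‖a - a'‖ ≤ η := by
    have : a - a' = cfc (fun t : ℝ => t - max t η) a := by
      rw [cfc_sub _ _ a (by fun_prop) (by fun_prop), cfc_id' ℝ a]
    rw [this]
    refine norm_cfc_le hη.le fun t ht => ?_
    have h1 := spectrum_real_nonneg ha ht
    rw [Real.norm_eq_abs, abs_le]
    constructor
    · rcases max_cases t η with h | h <;> linarith
    · have := le_max_left t η
      linarith
  have hcl : η • B N ≤ s * a' * s := by
    have := star_left_conjugate_le_conjugate ha'l s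
    rwa [hsa.star_eq, mul_smul_comm, mul_one, smul_mul_assoc, hss] at this
  have hcu : s * a' * s ≤ ‖a‖ • B N := by
    have := star_left_conjugate_le_conjugate ha'u s
    rwa [hsa.star_eq, mul_smul_comm, mul_one, smul_mul_assoc, hss] at this
  have hc0 : 0 ≤ s * a' * s := by
    have := star_left_conjugate_nonneg ha'0 s
    rwa [hsa.star_eq] at this
  have hcB : s * a' * s ∈ her (B N) := mem_her_of_le (hB0 N) hc0 hcu
  have hBc : B N ∈ her (s * a' * s) := by
    refine mem_her_of_le hc0 (hB0 N) (C := η⁻¹) ?_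
    have := smul_le_smul_of_nonneg_left hcl (inv_nonneg.mpr hη.le)
    rwa [inv_smul_smul₀ hη.ne'] at this
  refine ⟨s * a' * s, her_subset_her ha (hBa N) hcB, hc0, ?_, ?_, ?_⟩
  · have h1 : ‖a'‖ ≤ ‖a‖ := by
      refine norm_cfc_le hM.le fun t ht => ?_
      rw [Real.norm_of_nonneg (hη.le.trans (le_max_right _ _))]
      exact max_le (hsp t ht) (min_le_left _ _)
    calc ‖s * a' * s‖ ≤ ‖s‖ * ‖a'‖ * ‖s‖ := norm_mul₃_le
      _ ≤ 1 * ‖a‖ * 1 := by gcongr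
      _ = ‖a‖ := by ring
  · refine (Real.iSup_le (fun τ => ?_) (half_pos hε).le).trans_lt (half_lt_self hε)
    refine Real.sqrt_le_iff.mpr ⟨(half_pos hε).le, ?_⟩
    have h1 := τ.2.re_star_mul_self_sub_conj_le (.of_nonneg ha) hs0 hs1 haa'
    have h2 := hN τ τ.2
    simp only [map_sub, Complex.sub_re, IsTracialState.re_smul, τ.2.re_one] at h2
    rw [hss] at h1
    have h3 : η ^ 2 ≤ (ε / 6) ^ 2 := by
      gcongr
      exact min_le_right _ _
    nlinarith [sq_nonneg ε]
  · have hgeo := hasSum_const_mul_geometric_two (ε / 8)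
    refine (osc_le_sum hT hb0 horth hc0 hcB hBc
      (δ := fun n => osc (b n) + ε / 8 * (1 / 2) ^ n) fun n => ?_).trans_lt ?_
    · exact lt_add_of_pos_right _ (by positivity)
    · have h1 := hosum.sum_le_tsum (Finset.range N) fun i _ => osc_nonneg (b i)
      have h2 := hgeo.summable.sum_le_tsum (Finset.range N) fun i _ => by positivity
      rw [hgeo.tsum_eq] at h2
      have h3 := hos.trans_le (min_le_left _ _)
      rw [Finset.sum_add_distrib]
      linarith

end Approximation

/-- Theorem 3.13 (decomposition theorem): in a unital simple C*-algebra with a tracial state,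
the following are equivalent: (i) every positive element has tracial approximate oscillation
zero; (ii) every positive `e` admits, for every `ε > 0`, a sequence of mutually orthogonal
positive contractions `(b_n)` in `Her(e)` with `∑ ω(b_n) < ε` and `d_τ(e) − ∑ τ(b_n) < ε` for
all tracial states `τ`; (iii) the same with `∑ d_τ(b_n)` in place of `∑ τ(b_n)`. -/
theorem taoZero_tfae [IsSimpleRing A] [PartialOrder A] [StarOrderedRing A]
    (hT : (traceSet A).Nonempty) :
    ((∀ a : A, 0 ≤ a → TAOZero a) ↔
      (∀ e : A, 0 ≤ e → ∀ ε : ℝ, 0 < ε → ∃ b : ℕ → A,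
        (∀ n, b n ∈ her e) ∧ (∀ n, 0 ≤ b n) ∧ (∀ n, ‖b n‖ ≤ 1) ∧
        (∀ n m, n ≠ m → b n * b m = 0) ∧
        (Summable fun n => osc (b n)) ∧ (∑' n, osc (b n)) < ε ∧
        ∀ τ : A →L[ℂ] ℂ, IsTracialState τ →
          (Summable fun n => (τ (b n)).re) ∧ dTau τ e - (∑' n, (τ (b n)).re) < ε))
    ∧
    ((∀ e : A, 0 ≤ e → ∀ ε : ℝ, 0 < ε → ∃ b : ℕ → A,
        (∀ n, b n ∈ her e) ∧ (∀ n, 0 ≤ b n) ∧ (∀ n, ‖b n‖ ≤ 1) ∧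
        (∀ n m, n ≠ m → b n * b m = 0) ∧
        (Summable fun n => osc (b n)) ∧ (∑' n, osc (b n)) < ε ∧
        ∀ τ : A →L[ℂ] ℂ, IsTracialState τ →
          (Summable fun n => (τ (b n)).re) ∧ dTau τ e - (∑' n, (τ (b n)).re) < ε) ↔
      (∀ e : A, 0 ≤ e → ∀ ε : ℝ, 0 < ε → ∃ b : ℕ → A,
        (∀ n, b n ∈ her e) ∧ (∀ n, 0 ≤ b n) ∧ (∀ n, ‖b n‖ ≤ 1) ∧
        (∀ n m, n ≠ m → b n * b m = 0) ∧
        (Summable fun n => osc (b n)) ∧ (∑' n, osc (b n)) < ε ∧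
        ∀ τ : A →L[ℂ] ℂ, IsTracialState τ →
          (Summable fun n => dTau τ (b n)) ∧ dTau τ e - (∑' n, dTau τ (b n)) < ε)) := by
  refine ⟨⟨fun hA e he ε hε => exists_seq_trace_of_taoZero hT hA he hε,
    fun hA a ha => taoZero_of_exists_seq hT ha (hA a ha)⟩, fun hA e he ε hε => ?_,
    fun hA e he ε hε => ?_⟩
  · obtain ⟨b, hbe, hb0, hb1, horth, hosum, hos, hτ⟩ := hA e he ε hε
    refine ⟨b, hbe, hb0, hb1, horth, hosum, hos, fun τ hτ' => ?_⟩
    obtain ⟨h1, h2⟩ := hτ τ hτ'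
    have h3 := hτ'.summable_dTau hb0 horth
    have h4 := h1.tsum_le_tsum (fun n => hτ'.re_le_dTau (hb0 n) (self_mem_her (hb0 n))
      ((CStarAlgebra.norm_le_one_iff_of_nonneg (b n)).mp (hb1 n))) h3
    exact ⟨h3, by linarith⟩
  · obtain ⟨b, hbe, hb0, -, horth, hosum, hos, hτ⟩ := hA e he (ε / 4) (by positivity)
    exact exists_seq_trace_of_seq_rank hT he hε hbe hb0 horth hosum hos fun τ hτ' => (hτ τ hτ').2
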